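/- The equation 3 J_ν(1) + 2(ν − 2) J_{ν+1}(1) = 0 has exactly one root ν₁ in the interval (−1, ∞), and this root satisfies −0.15 < ν₁ < −0.14. -/

import Mathlib

noncomputable section

/-- The Bessel function of the first kind `J_ν(x) = ∑ (−1)^n (x/2)^(2n+ν) / (n! Γ(ν+n+1))`
for real `x > 0`. -/
def besselJ (ν : ℝ) (x : ℝ) : ℝ :=
  ∑' n : ℕ, (-1 : ℝ) ^ n * (x / 2) ^ (2 * (n : ℝ) + ν) / (n.factorial * Real.Gamma (ν + n + 1))

/-- The reciprocal of the Pochhammer symbol `(s + 1)_n`. -/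
def invPoch (n : ℕ) (s : ℝ) : ℝ := ∏ i ∈ Finset.range n, (s + 1 + i)⁻¹

lemma invPoch_succ (n : ℕ) (s : ℝ) : invPoch (n + 1) s = invPoch n s * (s + 1 + n)⁻¹ :=
  Finset.prod_range_succ _ _

lemma invPoch_nonneg {s : ℝ} (hs : 0 ≤ s) (n : ℕ) : 0 ≤ invPoch n s :=
  Finset.prod_nonneg fun i _ => by positivity

lemma inv_shift_le {s : ℝ} (hs : 0 ≤ s) (n : ℕ) : (s + 1 + n)⁻¹ ≤ ((n : ℝ) + 1)⁻¹ :=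
  inv_anti₀ (by positivity) (by linarith)

lemma inv_factorial_succ (n : ℕ) :
    ((n + 1).factorial : ℝ)⁻¹ = (n.factorial : ℝ)⁻¹ * ((n : ℝ) + 1)⁻¹ := by
  rw [Nat.factorial_succ]; push_cast; rw [mul_inv, mul_comm]

lemma invPoch_le {s : ℝ} (hs : 0 ≤ s) (n : ℕ) : invPoch n s ≤ (n.factorial : ℝ)⁻¹ := by
  induction n with
  | zero => simp [invPoch]
  | succ n ih =>
    rw [invPoch_succ, inv_factorial_succ]
    exact mul_le_mul ih (inv_shift_le hs n) (by positivity) (by positivity)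

lemma inv_factorial_le_one (n : ℕ) : (n.factorial : ℝ)⁻¹ ≤ 1 :=
  inv_le_one_of_one_le₀ (by exact_mod_cast n.factorial_pos)

lemma cast_mul_inv_factorial_le_one (n : ℕ) : (n : ℝ) * (n.factorial : ℝ)⁻¹ ≤ 1 := by
  rw [← div_eq_mul_inv, div_le_one (by positivity)]
  exact_mod_cast n.self_le_factorial

lemma abs_invPoch_sub_le {s t : ℝ} (hs : 0 ≤ s) (ht : 0 ≤ t) (n : ℕ) :
    |invPoch n s - invPoch n t| ≤ n * (n.factorial : ℝ)⁻¹ * |s - t| := by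
  induction n with
  | zero => simp [invPoch]
  | succ n ih =>
    have hsplit : invPoch (n + 1) s - invPoch (n + 1) t =
        (invPoch n s - invPoch n t) * (s + 1 + n)⁻¹ +
          invPoch n t * ((s + 1 + n)⁻¹ * (t + 1 + n)⁻¹ * (t - s)) := by
      rw [invPoch_succ, invPoch_succ]
      have h1 : s + 1 + n ≠ 0 := by positivity
      have h2 : t + 1 + n ≠ 0 := by positivity
      field_simp
      ring
    have hA : |(invPoch n s - invPoch n t) * (s + 1 + n)⁻¹| ≤
        n * (n.factorial : ℝ)⁻¹ * |s - t| * ((n : ℝ) + 1)⁻¹ := by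
      rw [abs_mul, abs_of_nonneg (by positivity : 0 ≤ (s + 1 + n)⁻¹)]
      exact mul_le_mul ih (inv_shift_le hs n) (by positivity) (by positivity)
    have hB : |invPoch n t * ((s + 1 + n)⁻¹ * (t + 1 + n)⁻¹ * (t - s))| ≤
        (n.factorial : ℝ)⁻¹ * (((n : ℝ) + 1)⁻¹ * 1 * |s - t|) := by
      rw [abs_mul, abs_mul, abs_of_nonneg (invPoch_nonneg ht n), abs_sub_comm t s,
        abs_of_nonneg (by positivity : 0 ≤ (s + 1 + n)⁻¹ * (t + 1 + n)⁻¹)]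
      have h1 : (t + 1 + n)⁻¹ ≤ 1 :=
        inv_le_one_of_one_le₀ (by linarith [n.cast_nonneg (α := ℝ)])
      have h2 := inv_shift_le hs n
      have h3 := invPoch_le ht n
      refine mul_le_mul h3 (mul_le_mul_of_nonneg_right ?_ (abs_nonneg _)) (by positivity)
        (by positivity)
      exact mul_le_mul h2 h1 (by positivity) (by positivity)
    rw [hsplit, inv_factorial_succ]
    refine (abs_add_le _ _).trans ((add_le_add hA hB).trans (le_of_eq ?_))
    push_cast
    ring

lemma Gamma_add_one_add_nat {s : ℝ} (hs : 0 < s) (n : ℕ) :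
    (Real.Gamma (s + 1 + n))⁻¹ = (Real.Gamma (s + 1))⁻¹ * invPoch n s := by
  induction n with
  | zero => simp [invPoch]
  | succ n ih =>
    rw [invPoch_succ, ← mul_assoc, ← ih, Nat.cast_succ, ← add_assoc,
      Real.Gamma_add_one (by positivity), mul_inv, mul_comm]

lemma Gamma_add_nat {s : ℝ} (hs : 0 < s) (n : ℕ) :
    (Real.Gamma (s + n))⁻¹ = (Real.Gamma (s + 1))⁻¹ * ((s + n) * invPoch n s) := by
  have h : (Real.Gamma (s + n))⁻¹ = (s + n) * (Real.Gamma (s + 1 + n))⁻¹ := by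
    have h0 : s + n ≠ 0 := by positivity
    rw [add_right_comm, Real.Gamma_add_one h0, mul_inv, mul_inv_cancel_left₀ h0]
  rw [h, Gamma_add_one_add_nat hs]
  ring

/-- The coefficient of the normalized series of `J_{s}(1)`. -/
def besselCoeff (n : ℕ) (s : ℝ) : ℝ := (-1 / 4) ^ n * (n.factorial : ℝ)⁻¹ * invPoch n s

lemma half_rpow (n : ℕ) (ν : ℝ) :
    (-1 : ℝ) ^ n * (1 / 2 : ℝ) ^ (2 * (n : ℝ) + ν) = (-1 / 4) ^ n * (1 / 2 : ℝ) ^ ν := by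
  rw [Real.rpow_add (by norm_num), Real.rpow_mul (by norm_num), Real.rpow_natCast, ← mul_assoc,
    ← mul_pow]
  norm_num

lemma besselJ_eq {s : ℝ} (hs : 0 < s) :
    besselJ s 1 = (1 / 2 : ℝ) ^ s * (Real.Gamma (s + 1))⁻¹ * ∑' n, besselCoeff n s := by
  rw [besselJ, ← tsum_mul_left]
  refine tsum_congr fun n => ?_
  rw [half_rpow, div_eq_mul_inv, mul_inv, add_right_comm, Gamma_add_one_add_nat hs, besselCoeff]
  ring

lemma besselJ_sub_one_eq {s : ℝ} (hs : 0 < s) :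
    besselJ (s - 1) 1 =
      (1 / 2 : ℝ) ^ (s - 1) * (Real.Gamma (s + 1))⁻¹ * ∑' n : ℕ, (s + n) * besselCoeff n s := by
  rw [besselJ, ← tsum_mul_left]
  refine tsum_congr fun n => ?_
  rw [half_rpow, div_eq_mul_inv, mul_inv, show s - 1 + n + 1 = s + n by ring,
    Gamma_add_nat hs, besselCoeff]
  ring

lemma abs_besselCoeff_le {s : ℝ} (hs : 0 ≤ s) (n : ℕ) :
    |besselCoeff n s| ≤ (1 / 4) ^ n * ((n.factorial : ℝ)⁻¹ * (n.factorial : ℝ)⁻¹) := by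
  rw [besselCoeff, abs_mul, abs_mul, abs_pow, abs_of_nonneg (invPoch_nonneg hs n), mul_assoc,
    abs_of_nonneg (by positivity : 0 ≤ (n.factorial : ℝ)⁻¹)]
  norm_num
  gcongr
  exact invPoch_le hs n

lemma summable_besselCoeff {s : ℝ} (hs : 0 ≤ s) : Summable fun n => besselCoeff n s := by
  refine Summable.of_norm_bounded
    (summable_geometric_of_lt_one (by norm_num) (by norm_num : (1 / 4 : ℝ) < 1)) fun n => ?_
  refine (abs_besselCoeff_le hs n).trans (mul_le_of_le_one_right (by positivity) ?_)
  exact mul_le_one₀ (inv_factorial_le_one n) (by positivity) (inv_factorial_le_one n)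

lemma summable_cast_mul_besselCoeff {s : ℝ} (hs : 0 ≤ s) :
    Summable fun n : ℕ => (n : ℝ) * besselCoeff n s := by
  refine Summable.of_norm_bounded
    (summable_geometric_of_lt_one (by norm_num) (by norm_num : (1 / 4 : ℝ) < 1)) fun n => ?_
  rw [norm_mul, Real.norm_natCast, Real.norm_eq_abs]
  calc (n : ℝ) * |besselCoeff n s|
      ≤ n * ((1 / 4) ^ n * ((n.factorial : ℝ)⁻¹ * (n.factorial : ℝ)⁻¹)) := by
        gcongr; exact abs_besselCoeff_le hs n
    _ = (1 / 4) ^ n * (n * (n.factorial : ℝ)⁻¹ * (n.factorial : ℝ)⁻¹) := by ring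
    _ ≤ (1 / 4) ^ n := mul_le_of_le_one_right (by positivity)
        (mul_le_one₀ (cast_mul_inv_factorial_le_one n) (by positivity) (inv_factorial_le_one n))

/-- The terms of the normalized Dini series in `s = ν + 1`. -/
def diniTerm (n : ℕ) (s : ℝ) : ℝ := (4 * s - 3 + 3 * n) * besselCoeff n s

/-- The function `3 J_ν(1) + 2 (ν - 2) J_{ν+1}(1)` of `s = ν + 1`, up to a positive factor. -/
def diniSeries (s : ℝ) : ℝ := ∑' n, diniTerm n s

lemma summable_diniTerm {s : ℝ} (hs : 0 ≤ s) : Summable fun n => diniTerm n s :=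
  (((summable_besselCoeff hs).mul_left (4 * s - 3)).add
    ((summable_cast_mul_besselCoeff hs).mul_left 3)).congr fun n => by rw [diniTerm]; ring

lemma bessel_dini_eq {s : ℝ} (hs : 0 < s) :
    3 * besselJ (s - 1) 1 + 2 * (s - 1 - 2) * besselJ s 1 =
      (1 / 2 : ℝ) ^ (s - 1) * (Real.Gamma (s + 1))⁻¹ * diniSeries s := by
  have h1 := summable_besselCoeff hs.le
  have h2 : Summable fun n : ℕ => (s + n) * besselCoeff n s :=
    ((h1.mul_left s).add (summable_cast_mul_besselCoeff hs.le)).congr fun n => by ring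
  have hD : diniSeries s =
      3 * ∑' n : ℕ, (s + n) * besselCoeff n s + (s - 3) * ∑' n, besselCoeff n s := by
    rw [diniSeries, ← tsum_mul_left, ← tsum_mul_left,
      ← (h2.mul_left 3).tsum_add (h1.mul_left (s - 3))]
    exact tsum_congr fun n => by rw [diniTerm]; ring
  have hp : (1 / 2 : ℝ) ^ s = (1 / 2) ^ (s - 1) * (1 / 2) := by
    rw [Real.rpow_sub_one (by norm_num)]; norm_num
  rw [hD, besselJ_eq hs, besselJ_sub_one_eq hs, hp]
  ring

lemma bessel_dini_eq_zero_iff {s : ℝ} (hs : 0 < s) :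
    3 * besselJ (s - 1) 1 + 2 * (s - 1 - 2) * besselJ s 1 = 0 ↔ diniSeries s = 0 := by
  have hG : Real.Gamma (s + 1) ≠ 0 := (Real.Gamma_pos_of_pos (by positivity)).ne'
  have hp : (1 / 2 : ℝ) ^ (s - 1) ≠ 0 := by positivity
  rw [bessel_dini_eq hs, mul_eq_zero_iff_left (mul_ne_zero hp (inv_ne_zero hG))]

lemma diniTerm_succ {s : ℝ} (hs : 0 ≤ s) (n : ℕ) :
    diniTerm (n + 1) s = (-1 / 4) ^ (n + 1) * ((n + 1).factorial : ℝ)⁻¹ *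
      (4 * invPoch n s - (n + 4) * invPoch (n + 1) s) := by
  have h : s + 1 + n ≠ 0 := by positivity
  rw [diniTerm, besselCoeff, invPoch_succ]
  push_cast
  field_simp
  ring

lemma abs_diniTerm_succ_sub_le {s t : ℝ} (hs : 0 ≤ s) (ht : 0 ≤ t) (n : ℕ) :
    |diniTerm (n + 1) s - diniTerm (n + 1) t| ≤ 2 * |s - t| * (1 / 4) ^ n := by
  have hlip (m : ℕ) : |invPoch m s - invPoch m t| ≤ |s - t| :=
    (abs_invPoch_sub_le hs ht m).trans
      (mul_le_of_le_one_left (abs_nonneg _) (cast_mul_inv_factorial_le_one m))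
  have hsub : diniTerm (n + 1) s - diniTerm (n + 1) t =
      (-1 / 4) ^ (n + 1) * ((n + 1).factorial : ℝ)⁻¹ *
        (4 * (invPoch n s - invPoch n t) - (n + 4) * (invPoch (n + 1) s - invPoch (n + 1) t)) := by
    rw [diniTerm_succ hs, diniTerm_succ ht]; ring
  have hin : |4 * (invPoch n s - invPoch n t) -
      (n + 4) * (invPoch (n + 1) s - invPoch (n + 1) t)| ≤ (n + 8) * |s - t| := by
    refine (abs_sub _ _).trans ?_
    rw [abs_mul, abs_mul, abs_of_nonneg (by positivity : (0 : ℝ) ≤ (n : ℝ) + 4),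
      abs_of_nonneg (by norm_num : (0 : ℝ) ≤ 4)]
    nlinarith [hlip n, hlip (n + 1), n.cast_nonneg (α := ℝ)]
  have hfac : ((n + 1).factorial : ℝ)⁻¹ * (n + 8) ≤ 8 := by
    have h1 := cast_mul_inv_factorial_le_one (n + 1)
    have h2 := inv_factorial_le_one (n + 1)
    push_cast at h1
    linarith
  rw [hsub, abs_mul, abs_mul, abs_pow,
    abs_of_nonneg (by positivity : (0 : ℝ) ≤ ((n + 1).factorial : ℝ)⁻¹)]
  calc _ ≤ |(-1 / 4 : ℝ)| ^ (n + 1) * ((n + 1).factorial : ℝ)⁻¹ * ((n + 8) * |s - t|) := by gcongr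
    _ = (1 / 4) ^ (n + 1) * (((n + 1).factorial : ℝ)⁻¹ * (n + 8)) * |s - t| := by
        norm_num; ring
    _ ≤ (1 / 4) ^ (n + 1) * 8 * |s - t| := by gcongr
    _ = 2 * |s - t| * (1 / 4) ^ n := by ring

lemma abs_diniSeries_sub_le {s t : ℝ} (hs : 0 ≤ s) (ht : 0 ≤ t) :
    |diniSeries s - diniSeries t - 4 * (s - t)| ≤ 8 / 3 * |s - t| := by
  have hzero (r : ℝ) : diniTerm 0 r = 4 * r - 3 := by simp [diniTerm, besselCoeff, invPoch]
  have h1 := (summable_nat_add_iff 1).2 (summable_diniTerm hs)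
  have h2 := (summable_nat_add_iff 1).2 (summable_diniTerm ht)
  have heq : diniSeries s - diniSeries t - 4 * (s - t) =
      ∑' n, (diniTerm (n + 1) s - diniTerm (n + 1) t) := by
    rw [h1.tsum_sub h2, diniSeries, diniSeries, (summable_diniTerm hs).tsum_eq_zero_add,
      (summable_diniTerm ht).tsum_eq_zero_add, hzero, hzero]
    ring
  have hgeo := (hasSum_geometric_of_lt_one (by norm_num)
    (by norm_num : (1 / 4 : ℝ) < 1)).mul_left (2 * |s - t|)
  rw [heq]
  have h := tsum_of_norm_bounded hgeo
    (f := fun n => diniTerm (n + 1) s - diniTerm (n + 1) t) (abs_diniTerm_succ_sub_le hs ht)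
  rw [Real.norm_eq_abs] at h
  linarith

lemma strictMonoOn_diniSeries : StrictMonoOn diniSeries (Set.Ici 0) := by
  intro s hs t ht hst
  have h := (abs_le.1 (abs_diniSeries_sub_le ht hs)).1
  rw [abs_of_pos (sub_pos.2 hst)] at h
  linarith

lemma continuousOn_diniSeries : ContinuousOn diniSeries (Set.Ici 0) := by
  refine (LipschitzOnWith.of_dist_le_mul (K := 7) fun s hs t ht => ?_).continuousOn
  have h := abs_diniSeries_sub_le hs ht
  have h4 : |4 * (s - t)| = 4 * |s - t| := by rw [abs_mul]; norm_num
  have := abs_sub_abs_le_abs_sub (diniSeries s - diniSeries t) (4 * (s - t))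
  rw [Real.dist_eq, Real.dist_eq]
  push_cast
  linarith [abs_nonneg (s - t)]

lemma abs_diniTerm_add_three_le {s : ℝ} (hs : 3 / 4 ≤ s) (hs' : s ≤ 0.86) (n : ℕ) :
    |diniTerm (n + 3) s| ≤ 0.27 / 64 * (1 / 4) ^ n := by
  have hn : (0 : ℝ) ≤ n := n.cast_nonneg
  have hf6 : (6 : ℝ) ≤ (n + 3).factorial := by
    exact_mod_cast Nat.factorial_le (Nat.le_add_left 3 n)
  have hf2 : 2 * ((n : ℝ) + 3) ≤ (n + 3).factorial := by
    have h : 2 ≤ (n + 2).factorial := Nat.factorial_le (Nat.le_add_left 2 n)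
    have : 2 * (n + 3) ≤ (n + 3).factorial := by
      rw [Nat.factorial_succ]; nlinarith
    exact_mod_cast this
  have hfac : (4 * s - 3 + 3 * ((n : ℝ) + 3)) *
      (((n + 3).factorial : ℝ)⁻¹ * ((n + 3).factorial : ℝ)⁻¹) ≤ 0.27 := by
    rw [← mul_inv, ← div_eq_mul_inv, div_le_iff₀ (by positivity)]
    nlinarith
  have hpos : 0 ≤ 4 * s - 3 + 3 * ((n : ℝ) + 3) := by linarith
  rw [diniTerm, abs_mul]
  push_cast
  rw [abs_of_nonneg hpos]
  calc _ ≤ (4 * s - 3 + 3 * ((n : ℝ) + 3)) * ((1 / 4) ^ (n + 3) *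
        (((n + 3).factorial : ℝ)⁻¹ * ((n + 3).factorial : ℝ)⁻¹)) := by
        gcongr; exact abs_besselCoeff_le (by linarith) _
    _ = ((4 * s - 3 + 3 * ((n : ℝ) + 3)) *
        (((n + 3).factorial : ℝ)⁻¹ * ((n + 3).factorial : ℝ)⁻¹)) * (1 / 4) ^ (n + 3) := by ring
    _ ≤ 0.27 * (1 / 4) ^ (n + 3) := by gcongr
    _ = _ := by ring

lemma abs_diniSeries_sub_partial_le {s : ℝ} (hs : 3 / 4 ≤ s) (hs' : s ≤ 0.86) :
    |diniSeries s - (4 * s - 3 - s * (s + 1)⁻¹ +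
      (4 * s + 3) / 32 * ((s + 1)⁻¹ * (s + 2)⁻¹))| ≤ 0.006 := by
  have hsum := summable_diniTerm (s := s) (by linarith)
  have heq : diniSeries s - (4 * s - 3 - s * (s + 1)⁻¹ +
      (4 * s + 3) / 32 * ((s + 1)⁻¹ * (s + 2)⁻¹)) = ∑' n, diniTerm (n + 3) s := by
    rw [diniSeries, ← hsum.sum_add_tsum_nat_add 3]
    have h2 : s + 1 + 1 = s + 2 := by ring
    simp [Finset.sum_range_succ, diniTerm, besselCoeff, invPoch, Finset.prod_range_succ, h2,
      Nat.factorial]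
    ring
  have hgeo := (hasSum_geometric_of_lt_one (by norm_num)
    (by norm_num : (1 / 4 : ℝ) < 1)).mul_left (0.27 / 64)
  rw [heq]
  have h := tsum_of_norm_bounded hgeo
    (f := fun n => diniTerm (n + 3) s) (abs_diniTerm_add_three_le hs hs')
  rw [Real.norm_eq_abs] at h
  exact h.trans (by norm_num)

/-- The equation `3 J_ν(1) + 2 (ν - 2) J_{ν+1}(1) = 0` has exactly one root `ν₁` in `(-1, ∞)`,
and `-0.15 < ν₁ < -0.14`. -/
theorem bessel_dini_root : ∃ ν₁ : ℝ,
    (-1 < ν₁ ∧ 3 * besselJ ν₁ 1 + 2 * (ν₁ - 2) * besselJ (ν₁ + 1) 1 = 0) ∧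
    (∀ ν : ℝ, -1 < ν → 3 * besselJ ν 1 + 2 * (ν - 2) * besselJ (ν + 1) 1 = 0 → ν = ν₁) ∧
    -0.15 < ν₁ ∧ ν₁ < -0.14 := by
  have hiff (ν : ℝ) (hν : -1 < ν) :
      3 * besselJ ν 1 + 2 * (ν - 2) * besselJ (ν + 1) 1 = 0 ↔ diniSeries (ν + 1) = 0 := by
    simpa using bessel_dini_eq_zero_iff (s := ν + 1) (by linarith)
  have hlow : diniSeries 0.85 < 0 := by
    have h := (abs_le.1 (abs_diniSeries_sub_partial_le (s := 0.85) (by norm_num) (by norm_num))).2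
    norm_num at h ⊢
    linarith
  have hhigh : 0 < diniSeries 0.86 := by
    have h := (abs_le.1 (abs_diniSeries_sub_partial_le (s := 0.86) (by norm_num) (by norm_num))).1
    norm_num at h ⊢
    linarith
  have hcont : ContinuousOn diniSeries (Set.Icc 0.85 0.86) :=
    continuousOn_diniSeries.mono fun x hx => le_trans (by norm_num) hx.1
  obtain ⟨s, ⟨hs1, hs2⟩, hs0⟩ := intermediate_value_Ioo (by norm_num) hcont ⟨hlow, hhigh⟩
  have hs : 0 < s := lt_trans (by norm_num) hs1
  refine ⟨s - 1, ⟨by linarith, (hiff _ (by linarith)).2 (by simpa using hs0)⟩,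
    fun ν hν h => ?_, by norm_num at hs1 ⊢; linarith, by norm_num at hs2 ⊢; linarith⟩
  have hν0 : (0 : ℝ) ≤ ν + 1 := by linarith
  have := strictMonoOn_diniSeries.injOn hν0 hs.le (((hiff ν hν).1 h).trans hs0.symm)
  linarith
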